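/- For 0 < |q| < 1: (q;q)_∞ ∑_{n=1}^{∞} q^{2n² − n} / ((1 + q^n)(q;q)_{2n−1}) = (−q^{10}, −q^{14}, q^{24}; q^{24})_∞ − (−q^{11}, −q^{13}, q^{24}; q^{24})_∞ + q(−q^{5}, −q^{19}, q^{24}; q^{24})_∞ − q²(−q^{2}, −q^{22}, q^{24}; q^{24})_∞. -/

import Mathlib

noncomputable def qp (q x : ℂ) (n : ℕ) : ℂ := ∏ i ∈ Finset.range n, (1 - x * q ^ i)

noncomputable def qpInf (q x : ℂ) : ℂ := ∏' i : ℕ, (1 - x * q ^ i)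

noncomputable def tp (Q a b : ℂ) : ℂ := qpInf Q a * qpInf Q b * qpInf Q Q

open Filter Topology

/-- Gaussian binomial coefficients. -/
noncomputable def gb (Q : ℂ) : ℕ → ℕ → ℂ
  | _, 0 => 1
  | 0, _ + 1 => 0
  | N + 1, k + 1 => Q ^ (k + 1) * gb Q N (k + 1) + gb Q N k

lemma gb_zero_right (Q : ℂ) (N : ℕ) : gb Q N 0 = 1 := by cases N <;> simp [gb]

lemma gb_lt (Q : ℂ) : ∀ N k : ℕ, N < k → gb Q N k = 0
  | 0, 0, h => by omega
  | 0, k + 1, _ => by simp [gb]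
  | N + 1, 0, h => by omega
  | N + 1, k + 1, h => by
    simp [gb, gb_lt Q N (k + 1) (by omega), gb_lt Q N k (by omega)]

lemma qp_succ (q x : ℂ) (n : ℕ) : qp q x (n + 1) = qp q x n * (1 - x * q ^ n) := by
  simp [qp, Finset.prod_range_succ]

lemma qp_zero (q x : ℂ) : qp q x 0 = 1 := by simp [qp]

lemma gb_closed (Q : ℂ) (N : ℕ) : ∀ j k : ℕ, j + k = N →
    gb Q N k * (qp Q Q k * qp Q Q j) = qp Q Q N := by
  induction N with
  | zero =>
    intro j k h
    obtain ⟨rfl, rfl⟩ : j = 0 ∧ k = 0 := by omega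
    simp [gb, qp_zero]
  | succ N ih =>
    intro j k h
    rcases k with _ | k
    · obtain rfl : j = N + 1 := by omega
      simp [gb, qp_zero]
    · rw [gb]
      have h2 := ih j k (by omega)
      rcases j with _ | j
      · rw [gb_lt Q N (k + 1) (by omega)]
        obtain rfl : k = N := by omega
        simp only [qp_zero, mul_one] at h2
        rw [qp_succ, qp_zero]
        linear_combination (1 - Q * Q ^ k) * h2
      · have h1 := ih j (k + 1) (by omega)
        obtain rfl : N = j + k + 1 := by omega
        rw [qp_succ Q Q (j + k + 1)]
        rw [qp_succ Q Q k] at *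
        rw [qp_succ Q Q j] at *
        linear_combination (Q ^ (k + 1) * (1 - Q * Q ^ j)) * h1 + (1 - Q * Q ^ k) * h2

/-- q-binomial theorem -/
lemma qbinom (Q : ℂ) (N : ℕ) : ∀ x : ℂ, qp Q (-x) N =
    ∑ k ∈ Finset.range (N + 1), gb Q N k * (Q ^ (k.choose 2) * x ^ k) := by
  induction N with
  | zero => intro x; simp [qp_zero, gb]
  | succ N ih =>
    intro x
    have h1 : qp Q (-x) (N + 1) = (1 + x) * qp Q (-(x * Q)) N := by
      simp only [qp]
      rw [Finset.prod_range_succ']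
      rw [mul_comm]
      congr 1
      · simp
      · apply Finset.prod_congr rfl
        intro i _
        ring
    rw [h1, ih, Finset.sum_range_succ' _ (N + 1)]
    have h2 : ∀ k, gb Q (N + 1) (k + 1) * (Q ^ ((k + 1).choose 2) * x ^ (k + 1)) =
        gb Q N (k + 1) * (Q ^ ((k + 1).choose 2) * (x * Q) ^ (k + 1))
        + x * (gb Q N k * (Q ^ (k.choose 2) * (x * Q) ^ k)) := by
      intro k
      rw [gb, Nat.choose_succ_succ' k 1, Nat.choose_one_right]
      ring
    simp only [h2]
    rw [Finset.sum_add_distrib, ← Finset.mul_sum, gb_zero_right, add_mul, one_mul]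
    have h3 : ∑ k ∈ Finset.range (N + 1), gb Q N k * (Q ^ (k.choose 2) * (x * Q) ^ k)
      = ∑ k ∈ Finset.range (N + 1),
        gb Q N (k + 1) * (Q ^ ((k + 1).choose 2) * (x * Q) ^ (k + 1)) + 1 := by
      have := Finset.sum_range_succ' (fun k => gb Q N k * (Q ^ (k.choose 2) * (x * Q) ^ k)) (N + 1)
      rw [Finset.sum_range_succ, gb_lt Q N (N + 1) (by omega)] at this
      simpa [gb_zero_right] using this
    simp only [Nat.choose_zero_succ, pow_zero, mul_one]
    linear_combination h3

lemma summable_geo (q x : ℂ) (hq : ‖q‖ < 1) : Summable fun i : ℕ => ‖-(x * q ^ i)‖ := by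
  simp only [norm_neg, norm_mul, norm_pow]
  exact (summable_geometric_of_lt_one (norm_nonneg _) hq).mul_left _

lemma qp_tendsto (q x : ℂ) (hq : ‖q‖ < 1) : Tendsto (qp q x) atTop (𝓝 (qpInf q x)) := by
  have := (multipliable_one_add_of_summable (summable_geo q x hq)).tendsto_prod_tprod_nat
  have h : qp q x = fun n => ∏ i ∈ Finset.range n, (1 + -(x * q ^ i)) := by
    funext n
    simp only [qp, sub_eq_add_neg]
  rw [h]
  simpa only [qpInf, sub_eq_add_neg] using this

lemma one_sub_ne (q : ℂ) (hq : ‖q‖ < 1) (i : ℕ) : 1 - q * q ^ i ≠ 0 := by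
  intro h
  have h1 : q ^ (i + 1) = 1 := by rw [pow_succ']; linear_combination -h
  have h2 : ‖q‖ ^ (i + 1) = 1 := by rw [← norm_pow, h1]; simp
  have := pow_lt_one₀ (norm_nonneg q) hq (Nat.succ_ne_zero i)
  simp only [Nat.succ_eq_add_one] at this
  linarith

lemma qp_ne (q : ℂ) (hq : ‖q‖ < 1) (n : ℕ) : qp q q n ≠ 0 :=
  Finset.prod_ne_zero_iff.mpr fun i _ => one_sub_ne q hq i

lemma qpInf_ne (q : ℂ) (hq : ‖q‖ < 1) : qpInf q q ≠ 0 := by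
  have := tprod_one_add_ne_zero_of_summable (f := fun i : ℕ => -(q * q ^ i))
    (fun i => by simpa only [← sub_eq_add_neg] using one_sub_ne q hq i) (summable_geo q q hq)
  simpa only [qpInf, sub_eq_add_neg] using this

lemma gb_eq (Q : ℂ) (hq : ‖Q‖ < 1) (N j k : ℕ) (h : j + k = N) :
    gb Q N k = qp Q Q N / (qp Q Q k * qp Q Q j) := by
  rw [eq_div_iff (mul_ne_zero (qp_ne Q hq _) (qp_ne Q hq _)), gb_closed Q N j k h]

lemma bdd_of_tendsto {u : ℕ → ℂ} {x : ℂ} (h : Tendsto u atTop (𝓝 x)) :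
    ∃ C, 0 ≤ C ∧ ∀ n, ‖u n‖ ≤ C := by
  obtain ⟨C, hC⟩ := (Metric.isBounded_range_of_tendsto u h).exists_norm_le
  exact ⟨C, (norm_nonneg _).trans (hC _ ⟨0, rfl⟩), fun n => hC _ ⟨n, rfl⟩⟩

lemma gb_bdd (Q : ℂ) (hq : ‖Q‖ < 1) : ∃ C, 0 ≤ C ∧ ∀ N k, ‖gb Q N k‖ ≤ C := by
  obtain ⟨A, hA0, hA⟩ := bdd_of_tendsto (qp_tendsto Q Q hq)
  obtain ⟨B, hB0, hB⟩ := bdd_of_tendsto ((qp_tendsto Q Q hq).inv₀ (qpInf_ne Q hq))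
  refine ⟨A * (B * B), by positivity, fun N k => ?_⟩
  by_cases h : N < k
  · rw [gb_lt Q N k h, norm_zero]; positivity
  · rw [gb_eq Q hq N (N - k) k (by omega), div_eq_mul_inv, mul_inv, norm_mul, norm_mul]
    exact mul_le_mul (hA _) (mul_le_mul (hB _) (hB _) (norm_nonneg _) hB0) (by positivity) hA0

lemma summable_theta (Q x : ℂ) (hq : ‖Q‖ < 1) :
    Summable fun k : ℕ => ‖Q ^ (k.choose 2) * x ^ k‖ := by
  by_cases hx : x = 0
  · apply summable_of_ne_finset_zero (s := {0})
    intro b hb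
    simp at hb
    simp [hx, hb]
  by_cases hQ : Q = 0
  · apply summable_of_ne_finset_zero (s := {0, 1})
    intro b hb
    simp at hb
    have : b.choose 2 ≠ 0 := (Nat.choose_pos (by omega)).ne'
    simp [hQ, this]
  apply summable_of_ratio_test_tendsto_lt_one (l := 0) one_pos
  · exact Eventually.of_forall fun k => by simp [hx, hQ]
  · have h : ∀ k : ℕ, ‖‖Q ^ ((k + 1).choose 2) * x ^ (k + 1)‖‖ / ‖‖Q ^ (k.choose 2) * x ^ k‖‖
        = ‖Q‖ ^ k * ‖x‖ := by
      intro k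
      rw [Nat.choose_succ_succ' k 1, Nat.choose_one_right]
      simp only [norm_norm, norm_mul, norm_pow]
      have := norm_ne_zero_iff.mpr hx
      have := norm_ne_zero_iff.mpr hQ
      field_simp
      ring
    simp only [h]
    simpa using (tendsto_pow_atTop_nhds_zero_of_lt_one (norm_nonneg Q) hq).mul_const ‖x‖

lemma euler (Q x : ℂ) (hq : ‖Q‖ < 1) :
    HasSum (fun k : ℕ => Q ^ (k.choose 2) * x ^ k / qp Q Q k) (qpInf Q (-x)) := by
  obtain ⟨C, hC0, hC⟩ := gb_bdd Q hq
  obtain ⟨B, hB0, hB⟩ := bdd_of_tendsto ((qp_tendsto Q Q hq).inv₀ (qpInf_ne Q hq))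
  have hs : Summable (fun k : ℕ => Q ^ (k.choose 2) * x ^ k / qp Q Q k) := by
    refine Summable.of_norm_bounded ((summable_theta Q x hq).mul_left B) fun k => ?_
    rw [div_eq_mul_inv, norm_mul, mul_comm]
    exact mul_le_mul_of_nonneg_right (hB k) (norm_nonneg _)
  have ht := tendsto_tsum_of_dominated_convergence (𝓕 := atTop)
    (f := fun N k : ℕ => gb Q N k * (Q ^ (k.choose 2) * x ^ k))
    (g := fun k : ℕ => Q ^ (k.choose 2) * x ^ k / qp Q Q k)
    ((summable_theta Q x hq).mul_left C) (fun k => ?_) (Eventually.of_forall fun N k => ?_)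
  · have he : ∀ N, ∑' k, gb Q N k * (Q ^ (k.choose 2) * x ^ k) = qp Q (-x) N := by
      intro N
      rw [qbinom, tsum_eq_sum]
      intro b hb
      simp at hb
      rw [gb_lt Q N b (by omega), zero_mul]
    simp only [he] at ht
    rw [tendsto_nhds_unique (qp_tendsto Q (-x) hq) ht]
    exact hs.hasSum
  · have h1 : Tendsto (fun N => qp Q Q N / (qp Q Q k * qp Q Q (N - k))) atTop
        (𝓝 (qpInf Q Q / (qp Q Q k * qpInf Q Q))) :=
      (qp_tendsto Q Q hq).div
        (((qp_tendsto Q Q hq).comp (tendsto_sub_atTop_nat k)).const_mul _)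
        (mul_ne_zero (qp_ne Q hq _) (qpInf_ne Q hq))
    have h2 : qpInf Q Q / (qp Q Q k * qpInf Q Q) = 1 / qp Q Q k := by
      have := qpInf_ne Q hq
      have := qp_ne Q hq k
      field_simp
    rw [h2] at h1
    have h3 : Tendsto (fun N => gb Q N k) atTop (𝓝 (1 / qp Q Q k)) := by
      refine h1.congr' ?_
      filter_upwards [eventually_ge_atTop k] with N hN
      rw [gb_eq Q hq N (N - k) k (by omega)]
    have := h3.mul_const (Q ^ (k.choose 2) * x ^ k)
    convert this using 2
    ring
  · rw [norm_mul]
    exact mul_le_mul_of_nonneg_right (hC _ _) (norm_nonneg _)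

lemma choose_two_zpow (p : ℂ) (k : ℕ) :
    (p ^ 2) ^ (k.choose 2) = p ^ ((k : ℤ) * (k - 1)) := by
  rw [← pow_mul, ← zpow_natCast]
  congr 1
  induction k with
  | zero => simp
  | succ k ih =>
    rw [Nat.choose_succ_succ' k 1, Nat.choose_one_right]
    push_cast at *
    linarith

lemma qp_add (Q x : ℂ) (m n : ℕ) : qp Q x (m + n) = qp Q x m * qp Q (x * Q ^ m) n := by
  simp only [qp, Finset.prod_range_add]
  congr 1
  apply Finset.prod_congr rfl
  intro i _
  ring

lemma qp_flip (p z : ℂ) (hp : p ≠ 0) (hz : z ≠ 0) (n : ℕ) :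
    qp (p ^ 2) (-(z / (p ^ 2) ^ n)) n = z ^ n / p ^ (n * (n + 1)) * qp (p ^ 2) (-(p ^ 2 / z)) n := by
  induction n with
  | zero => simp [qp_zero]
  | succ n ih =>
    have h1 : qp (p ^ 2) (-(z / (p ^ 2) ^ (n + 1))) (n + 1)
        = (1 + z / (p ^ 2) ^ (n + 1)) * qp (p ^ 2) (-(z / (p ^ 2) ^ n)) n := by
      simp only [qp]
      rw [Finset.prod_range_succ', mul_comm]
      congr 1
      · simp
      · apply Finset.prod_congr rfl
        intro i _
        field_simp
        ring
    rw [h1, ih, qp_succ]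
    have h2 : (1 + z / (p ^ 2) ^ (n + 1)) = z / (p ^ 2) ^ (n + 1) * (1 - -(p ^ 2 / z) * (p ^ 2) ^ n) := by
      field_simp
      ring
    have h3 : z ^ (n + 1) / p ^ ((n + 1) * (n + 1 + 1)) =
        z ^ n / p ^ (n * (n + 1)) * (z / (p ^ 2) ^ (n + 1)) := by
      rw [div_mul_div_comm, ← pow_succ, ← pow_mul, ← pow_add]
      congr 2
      ring
    rw [h2, h3]
    ring

lemma finite_jtp (p z : ℂ) (hp : p ≠ 0) (hz : z ≠ 0) (n : ℕ) :
    qp (p ^ 2) (-z) n * qp (p ^ 2) (-(p ^ 2 / z)) n =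
    ∑ k ∈ Finset.range (2 * n + 1), gb (p ^ 2) (2 * n) k *
      (z ^ ((k : ℤ) - n) * p ^ (((k : ℤ) - n) * ((k : ℤ) - n - 1))) := by
  have h := qbinom (p ^ 2) (2 * n) (z / (p ^ 2) ^ n)
  rw [two_mul, qp_add, qp_flip p z hp hz n] at h
  have h0 : -(z / (p ^ 2) ^ n) * (p ^ 2) ^ n = -z := by field_simp
  rw [h0, ← two_mul] at h
  have hc : z ^ n / p ^ (n * (n + 1)) ≠ 0 := by positivity
  apply mul_left_cancel₀ hc
  rw [Finset.mul_sum]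
  calc _ = _ := by ring
    _ = _ := h
    _ = _ := by
      apply Finset.sum_congr rfl
      intro k _
      rw [choose_two_zpow p]
      have e1 : (z / (p ^ 2) ^ n) ^ k = z ^ (k : ℤ) * p ^ (-(2 * n * k : ℤ)) := by
        rw [div_pow, zpow_neg, ← div_eq_mul_inv, ← pow_mul, ← pow_mul]
        norm_cast
        rw [mul_assoc]
      have e2 : z ^ n / p ^ (n * (n + 1)) = z ^ (n : ℤ) * p ^ (-(n * (n + 1) : ℤ)) := by
        rw [zpow_neg, ← div_eq_mul_inv]
        norm_cast
      have e3 : z ^ (k : ℤ) = z ^ (n : ℤ) * z ^ ((k : ℤ) - n) := by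
        rw [← zpow_add₀ hz]; congr 1; ring
      have e4 : p ^ ((k : ℤ) * (k - 1)) * p ^ (-(2 * n * k : ℤ)) =
          p ^ (-(n * (n + 1) : ℤ)) * p ^ (((k : ℤ) - n) * ((k : ℤ) - n - 1)) := by
        rw [← zpow_add₀ hp, ← zpow_add₀ hp]; congr 1; ring
      rw [e1, e2, e3]
      linear_combination gb (p ^ 2) (2 * n) k * z ^ (n : ℤ) * z ^ ((k : ℤ) - n) * e4

lemma summable_int_theta (p z : ℂ) (hp : p ≠ 0) (h1 : ‖p‖ < 1) :
    Summable fun j : ℤ => ‖z ^ j * p ^ (j * (j - 1))‖ := by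
  have hQ : ‖p ^ 2‖ < 1 := by
    rw [norm_pow]; exact pow_lt_one₀ (norm_nonneg _) h1 two_ne_zero
  apply Summable.of_nat_of_neg
  · refine (summable_theta (p ^ 2) z hQ).congr fun k => ?_
    rw [choose_two_zpow p, zpow_natCast, mul_comm]
  · refine (summable_theta (p ^ 2) (p ^ 2 / z) hQ).congr fun k => ?_
    rw [choose_two_zpow p]
    congr 1
    have : (p ^ 2 / z) ^ k = p ^ (2 * k : ℤ) * z ^ (-(k : ℤ)) := by
      rw [div_pow, zpow_neg, ← div_eq_mul_inv, ← pow_mul]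
      norm_cast
    rw [this, ← mul_assoc, ← zpow_add₀ hp, mul_comm]
    congr 2
    ring

/-- Jacobi triple product -/
lemma jtp (p z : ℂ) (hp : p ≠ 0) (hz : z ≠ 0) (h1 : ‖p‖ < 1) :
    HasSum (fun j : ℤ => z ^ j * p ^ (j * (j - 1))) (tp (p ^ 2) (-z) (-(p ^ 2 / z))) := by
  have hQ : ‖p ^ 2‖ < 1 := by
    rw [norm_pow]; exact pow_lt_one₀ (norm_nonneg _) h1 two_ne_zero
  obtain ⟨C, hC0, hC⟩ := gb_bdd (p ^ 2) hQ
  have hs := summable_int_theta p z hp h1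
  have hne := qpInf_ne _ hQ
  have ht := tendsto_tsum_of_dominated_convergence (𝓕 := atTop)
    (f := fun (n : ℕ) (j : ℤ) => if 0 ≤ j + n then
      gb (p ^ 2) (2 * n) (j + n).toNat * (z ^ j * p ^ (j * (j - 1))) else 0)
    (g := fun j : ℤ => (qpInf (p ^ 2) (p ^ 2))⁻¹ * (z ^ j * p ^ (j * (j - 1))))
    (hs.mul_left C) (fun j => ?_) (Eventually.of_forall fun n j => ?_)
  · have he : ∀ n : ℕ, ∑' j : ℤ, (if 0 ≤ j + n then
        gb (p ^ 2) (2 * n) (j + n).toNat * (z ^ j * p ^ (j * (j - 1))) else 0)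
        = qp (p ^ 2) (-z) n * qp (p ^ 2) (-(p ^ 2 / z)) n := by
      intro n
      have hinj : Function.Injective fun k : ℕ => (k : ℤ) - n := by
        intro a b hab
        simp at hab
        exact hab
      rw [finite_jtp p z hp hz, ← hinj.tsum_eq, tsum_eq_sum (s := Finset.range (2 * n + 1))]
      · apply Finset.sum_congr rfl
        intro k _
        simp
      · intro b hb
        simp at hb
        simp [gb_lt (p ^ 2) (2 * n) b (by omega)]
      · intro j hj
        by_cases h : 0 ≤ j + n
        · exact ⟨(j + n).toNat, by simp only []; omega⟩
        · simp [h] at hj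
    simp only [he] at ht
    have hu := tendsto_nhds_unique
      ((qp_tendsto (p ^ 2) (-z) hQ).mul (qp_tendsto (p ^ 2) (-(p ^ 2 / z)) hQ)) ht
    rw [tsum_mul_left] at hu
    have : tp (p ^ 2) (-z) (-(p ^ 2 / z)) = ∑' j : ℤ, z ^ j * p ^ (j * (j - 1)) := by
      rw [tp, hu]
      field_simp
    rw [this]
    exact hs.of_norm.hasSum
  · have h1 : Tendsto (fun n : ℕ => qp (p ^ 2) (p ^ 2) (2 * n) /
        (qp (p ^ 2) (p ^ 2) (n + j).toNat * qp (p ^ 2) (p ^ 2) (n - j).toNat)) atTop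
        (𝓝 (qpInf (p ^ 2) (p ^ 2) / (qpInf (p ^ 2) (p ^ 2) * qpInf (p ^ 2) (p ^ 2)))) := by
      have T := qp_tendsto (p ^ 2) (p ^ 2) hQ
      have t1 : Tendsto (fun n : ℕ => 2 * n) atTop atTop :=
        tendsto_atTop_mono (fun n => show n ≤ 2 * n by omega) tendsto_id
      have t2 : Tendsto (fun n : ℕ => ((n : ℤ) + j).toNat) atTop atTop := by
        refine tendsto_atTop.mpr fun b => ?_
        filter_upwards [eventually_ge_atTop (b + j.natAbs)] with n hn
        omega
      have t3 : Tendsto (fun n : ℕ => ((n : ℤ) - j).toNat) atTop atTop := by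
        refine tendsto_atTop.mpr fun b => ?_
        filter_upwards [eventually_ge_atTop (b + j.natAbs)] with n hn
        omega
      exact (T.comp t1).div ((T.comp t2).mul (T.comp t3)) (mul_ne_zero hne hne)
    have h2 : qpInf (p ^ 2) (p ^ 2) / (qpInf (p ^ 2) (p ^ 2) * qpInf (p ^ 2) (p ^ 2)) =
        (qpInf (p ^ 2) (p ^ 2))⁻¹ := by
      field_simp
    rw [h2] at h1
    refine (h1.mul_const (z ^ j * p ^ (j * (j - 1)))).congr' ?_
    filter_upwards [eventually_ge_atTop j.natAbs] with n hn
    rw [if_pos (by omega), add_comm j, gb_eq (p ^ 2) hQ (2 * n) (n - j).toNat (n + j).toNat (by omega)]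
  · split_ifs
    · rw [norm_mul]
      exact mul_le_mul_of_nonneg_right (hC _ _) (norm_nonneg _)
    · rw [norm_zero]; positivity

lemma norm_pow_lt (s : ℂ) (h : ‖s‖ < 1) (n : ℕ) (hn : n ≠ 0) : ‖s ^ n‖ < 1 := by
  rw [norm_pow]; exact pow_lt_one₀ (norm_nonneg _) h hn

lemma mul_atTop (c : ℕ) (hc : 0 < c) : Tendsto (fun n : ℕ => c * n) atTop atTop :=
  tendsto_atTop_mono (fun n => show n ≤ c * n from Nat.le_mul_of_pos_left n hc) tendsto_id

lemma qpInf_three (r : ℂ) (h : ‖r‖ < 1) : qpInf r r = tp (r ^ 3) r (r ^ 2) := by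
  have h3 := norm_pow_lt r h 3 (by norm_num)
  have hf : ∀ n, qp r r (3 * n) = qp (r ^ 3) r n * qp (r ^ 3) (r ^ 2) n * qp (r ^ 3) (r ^ 3) n := by
    intro n
    induction n with
    | zero => simp [qp_zero]
    | succ n ih =>
      rw [show 3 * (n + 1) = 3 * n + 1 + 1 + 1 by ring]
      simp only [qp_succ, ih]
      ring
  refine tendsto_nhds_unique ((qp_tendsto r r h).comp (mul_atTop 3 (by norm_num))) ?_
  refine (((qp_tendsto _ r h3).mul (qp_tendsto _ (r ^ 2) h3)).mul
    (qp_tendsto _ (r ^ 3) h3)).congr fun n => ?_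
  simp [hf]

lemma qpInf_two (r : ℂ) (h : ‖r‖ < 1) : qpInf r r = qpInf (r ^ 2) r * qpInf (r ^ 2) (r ^ 2) := by
  have h3 := norm_pow_lt r h 2 (by norm_num)
  have hf : ∀ n, qp r r (2 * n) = qp (r ^ 2) r n * qp (r ^ 2) (r ^ 2) n := by
    intro n
    induction n with
    | zero => simp [qp_zero]
    | succ n ih =>
      rw [show 2 * (n + 1) = 2 * n + 1 + 1 by ring]
      simp only [qp_succ, ih]
      ring
  refine tendsto_nhds_unique ((qp_tendsto r r h).comp (mul_atTop 2 (by norm_num))) ?_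
  refine ((qp_tendsto _ r h3).mul (qp_tendsto _ (r ^ 2) h3)).congr fun n => ?_
  simp [hf]

lemma qpInf_sq (r : ℂ) (h : ‖r‖ < 1) : qpInf r r * qpInf r (-r) = qpInf (r ^ 2) (r ^ 2) := by
  have h3 := norm_pow_lt r h 2 (by norm_num)
  refine tendsto_nhds_unique ((qp_tendsto r r h).mul (qp_tendsto r (-r) h)) ?_
  refine (qp_tendsto _ (r ^ 2) h3).congr fun n => ?_
  simp only [qp, ← Finset.prod_mul_distrib]
  apply Finset.prod_congr rfl
  intro i _
  ring

lemma qpInf_shift (q x : ℂ) (h : ‖q‖ < 1) : qpInf q x = (1 - x) * qpInf q (x * q) := by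
  refine tendsto_nhds_unique ((qp_tendsto q x h).comp (tendsto_add_atTop_nat 1)) ?_
  refine ((qp_tendsto q (x * q) h).const_mul (1 - x)).congr fun n => ?_
  simp only [qp, Function.comp]
  rw [Finset.prod_range_succ', mul_comm]
  congr 1
  · apply Finset.prod_congr rfl
    intro i _
    ring
  · simp

/-- pentagonal number theorem -/
lemma pent (s : ℂ) (hs : s ≠ 0) (h : ‖s‖ < 1) :
    HasSum (fun j : ℤ => (-1) ^ j * s ^ (3 * j ^ 2 - j)) (qpInf (s ^ 2) (s ^ 2)) := by
  have := jtp (s ^ 3) (-s ^ 2) (pow_ne_zero _ hs) (neg_ne_zero.mpr (pow_ne_zero _ hs))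
    (norm_pow_lt s h 3 (by norm_num))
  rw [qpInf_three _ (norm_pow_lt s h 2 (by norm_num))]
  have e : -((s ^ 3) ^ 2 / -s ^ 2) = (s ^ 2) ^ 2 := by field_simp
  rw [e, neg_neg, show (s ^ 3) ^ 2 = (s ^ 2) ^ 3 by ring] at this
  convert this using 2 with j
  rw [neg_eq_neg_one_mul (s ^ 2), mul_zpow, mul_assoc]
  congr 1
  rw [← zpow_natCast, ← zpow_natCast, ← zpow_mul, ← zpow_mul, ← zpow_add₀ hs]
  congr 1
  push_cast
  ring

lemma tp_sum (q : ℂ) (hq : q ≠ 0) (h : ‖q‖ < 1) (a b : ℕ) (hab : a + b = 24) :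
    HasSum (fun j : ℤ => q ^ (12 * j ^ 2 - (12 - a) * j)) (tp (q ^ 24) (-q ^ a) (-q ^ b)) := by
  have := jtp (q ^ 12) (q ^ a) (pow_ne_zero _ hq) (pow_ne_zero _ hq)
    (norm_pow_lt q h 12 (by norm_num))
  have e : (q ^ 12) ^ 2 / q ^ a = q ^ b := by
    rw [div_eq_iff (pow_ne_zero _ hq), ← pow_mul, ← pow_add]
    congr 1
    omega
  rw [e, ← pow_mul] at this
  convert this using 2 with j
  rw [← zpow_natCast, ← zpow_natCast, ← zpow_mul, ← zpow_mul, ← zpow_add₀ hq]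
  congr 1
  push_cast
  ring

lemma int_split (f : ℤ → ℂ) (hf : Summable f) :
    (Summable fun m : ℤ => f (2 * m)) ∧ (Summable fun m : ℤ => f (1 - 2 * m)) ∧
    ∑' j, f j = ∑' m : ℤ, f (2 * m) + ∑' m : ℤ, f (1 - 2 * m) := by
  have i1 : Function.Injective fun m : ℤ => 2 * m := fun a b h => by simp only at h; omega
  have i2 : Function.Injective fun m : ℤ => 1 - 2 * m := fun a b h => by simp only at h; omega
  have s1 := hf.comp_injective i1
  have s2 := hf.comp_injective i2
  refine ⟨s1, s2, ?_⟩
  have hc : IsCompl (Set.range fun m : ℤ => 2 * m) (Set.range fun m : ℤ => 1 - 2 * m) := by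
    have r1 : (Set.range fun m : ℤ => 2 * m) = { n : ℤ | Even n } := by
      ext x
      constructor
      · rintro ⟨m, rfl⟩
        exact even_two_mul m
      · rintro ⟨m, rfl⟩
        exact ⟨m, two_mul m⟩
    have r2 : (Set.range fun m : ℤ => 1 - 2 * m) = { n : ℤ | Odd n } := by
      ext x
      constructor
      · rintro ⟨m, rfl⟩
        exact ⟨-m, by ring⟩
      · rintro ⟨m, rfl⟩
        exact ⟨-m, by ring⟩
    rw [r1, r2]
    exact Int.isCompl_even_odd
  have e1 := (i1.hasSum_range_iff (f := f)).mpr s1.hasSum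
  have e2 := (i2.hasSum_range_iff (f := f)).mpr s2.hasSum
  exact (e1.add_isCompl hc e2).tsum_eq

lemma even_part (q x : ℂ) (h : ‖q‖ < 1) :
    HasSum (fun n : ℕ => q ^ ((2 * n).choose 2) * x ^ (2 * n) / qp q q (2 * n))
      ((qpInf q (-x) + qpInf q x) / 2) := by
  have h1 := euler q x h
  have h2 := euler q (-x) h
  rw [neg_neg] at h2
  have h3 := (h1.add h2).div_const 2
  have hinj : Function.Injective fun n : ℕ => 2 * n := fun a b h => by simp only at h; omega
  rw [← hinj.hasSum_iff] at h3
  · have e : (fun n : ℕ => q ^ ((2 * n).choose 2) * x ^ (2 * n) / qp q q (2 * n)) =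
        (fun i : ℕ => (q ^ i.choose 2 * x ^ i / qp q q i
          + q ^ i.choose 2 * (-x) ^ i / qp q q i) / 2) ∘ fun n => 2 * n := by
      funext n
      simp only [Function.comp_apply]
      rw [(even_two_mul n).neg_pow]
      ring
    rw [e]
    exact h3
  · intro k hk
    have : Odd k := by
      rw [← Nat.not_even_iff_odd]
      rintro ⟨m, rfl⟩
      exact hk ⟨m, by simp only; ring⟩
    rw [this.neg_pow]
    ring

lemma choose_even (n : ℕ) : (2 * n).choose 2 = 2 * n ^ 2 - n := by
  rw [Nat.choose_two_right]
  rcases n with _ | n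
  · simp
  · rw [show 2 * (n + 1) * (2 * (n + 1) - 1) = ((n + 1) * (2 * n + 1)) * 2 by
      rw [show 2 * (n + 1) - 1 = 2 * n + 1 by omega]; ring, Nat.mul_div_cancel _ two_pos]
    symm
    apply Nat.sub_eq_of_eq_add
    ring

lemma S1 (q : ℂ) (h : ‖q‖ < 1) :
    HasSum (fun n : ℕ => q ^ (2 * n ^ 2 - n) / qp q q (2 * n)) (qpInf q (-q)) := by
  have := even_part q 1 h
  rw [qpInf_shift q 1 h, qpInf_shift q (-1) h] at this
  simp only [choose_even, one_pow, mul_one] at this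
  convert this using 1
  ring_nf

lemma S2 (q p : ℂ) (hp : p ^ 2 = q) (h : ‖q‖ < 1) :
    HasSum (fun n : ℕ => q ^ (2 * n ^ 2) / qp q q (2 * n)) ((qpInf q (-p) + qpInf q p) / 2) := by
  have := even_part q p h
  simp only [choose_even] at this
  convert this using 3 with n
  rw [pow_mul p, hp, ← pow_add, Nat.sub_add_cancel]
  nlinarith

lemma R1 (q : ℂ) (hq : q ≠ 0) (h : ‖q‖ < 1) : qpInf (q ^ 2) (q ^ 2) =
    tp (q ^ 24) (-q ^ 10) (-q ^ 14) - q ^ 2 * tp (q ^ 24) (-q ^ 2) (-q ^ 22) := by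
  have hP := pent q hq h
  obtain ⟨-, -, e⟩ := int_split _ hP.summable
  rw [← hP.tsum_eq, e, ← (tp_sum q hq h 10 14 rfl).tsum_eq, ← (tp_sum q hq h 2 22 rfl).tsum_eq,
    ← tsum_mul_left, sub_eq_add_neg, ← tsum_neg]
  congr 1
  · congr 1
    funext m
    rw [(even_two_mul m).neg_one_zpow, one_mul]
    congr 1
    push_cast
    ring
  · congr 1
    funext m
    rw [(show Odd (1 - 2 * m) from ⟨-m, by ring⟩).neg_one_zpow, neg_one_mul, ← zpow_natCast,
      ← zpow_add₀ hq]
    congr 2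
    push_cast
    ring

lemma R2 (q s : ℂ) (hs4 : s ^ 4 = q) (hq : q ≠ 0) (h : ‖q‖ < 1) :
    qpInf q q * ((qpInf q (-s ^ 2) + qpInf q (s ^ 2)) / 2) =
    tp (q ^ 24) (-q ^ 11) (-q ^ 13) - q * tp (q ^ 24) (-q ^ 5) (-q ^ 19) := by
  have hs0 : s ≠ 0 := by rintro rfl; exact hq (by rw [← hs4]; norm_num)
  have hs : ‖s‖ < 1 := by
    by_contra hc
    have : 1 ≤ ‖s‖ ^ 4 := one_le_pow₀ (not_lt.mp hc)
    rw [← norm_pow, hs4] at this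
    linarith
  have hI0 : Complex.I * s ≠ 0 := mul_ne_zero Complex.I_ne_zero hs0
  have hI2 : (Complex.I * s) ^ 2 = -s ^ 2 := by rw [mul_pow, Complex.I_sq]; ring
  have hI4 : (Complex.I * s) ^ 4 = q := by
    rw [← hs4, show (Complex.I * s) ^ 4 = ((Complex.I * s) ^ 2) ^ 2 by ring, hI2]; ring
  have hP1 := pent s hs0 hs
  have hP2 := pent (Complex.I * s) hI0 (by simpa using hs)
  have hs2 := norm_pow_lt s hs 2 two_ne_zero
  rw [qpInf_two _ hs2, ← pow_mul, hs4] at hP1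
  rw [hI2, qpInf_two _ (by simpa using hs2), show (-s ^ 2) ^ 2 = s ^ 4 by ring, hs4] at hP2
  have hP := (hP1.add hP2).div_const 2
  have k0 : ∀ x : ℂ, x ^ 4 = q → ∀ k : ℤ, x ^ (4 * k) = q ^ k := by
    intro x hx k
    rw [zpow_mul, ← hx]
    norm_cast
  have k2 : ∀ x : ℂ, x ≠ 0 → x ^ 4 = q → ∀ k : ℤ, x ^ (4 * k + 2) = q ^ k * x ^ 2 := by
    intro x hx0 hx k
    rw [zpow_add₀ hx0, k0 x hx]
    norm_cast
  obtain ⟨s1, s2, e⟩ := int_split _ hP.summable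
  obtain ⟨-, -, e1⟩ := int_split _ s1
  obtain ⟨-, -, e2⟩ := int_split _ s2
  rw [show qpInf q q * ((qpInf q (-s ^ 2) + qpInf q (s ^ 2)) / 2) =
    (qpInf q (s ^ 2) * qpInf q q + qpInf q (-s ^ 2) * qpInf q q) / 2 by ring,
    ← hP.tsum_eq, e, e1, e2, ← (tp_sum q hq h 11 13 rfl).tsum_eq,
    ← (tp_sum q hq h 5 19 rfl).tsum_eq, ← tsum_mul_left]
  have z1 : ∀ m : ℤ, ((-1 : ℂ) ^ (2 * (2 * m)) * s ^ (3 * (2 * (2 * m)) ^ 2 - 2 * (2 * m)) +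
      (-1) ^ (2 * (2 * m)) * (Complex.I * s) ^ (3 * (2 * (2 * m)) ^ 2 - 2 * (2 * m))) / 2 =
      q ^ (12 * m ^ 2 - (12 - (11 : ℕ)) * m) := by
    intro m
    rw [(even_two_mul (2 * m)).neg_one_zpow, show 3 * (2 * (2 * m)) ^ 2 - 2 * (2 * m)
      = 4 * (12 * m ^ 2 - (12 - (11 : ℕ)) * m) by push_cast; ring, k0 _ hs4, k0 _ hI4]
    ring
  have z2 : ∀ m : ℤ, ((-1 : ℂ) ^ (2 * (1 - 2 * m)) *
        s ^ (3 * (2 * (1 - 2 * m)) ^ 2 - 2 * (1 - 2 * m)) +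
      (-1) ^ (2 * (1 - 2 * m)) *
        (Complex.I * s) ^ (3 * (2 * (1 - 2 * m)) ^ 2 - 2 * (1 - 2 * m))) / 2 = 0 := by
    intro m
    rw [show 3 * (2 * (1 - 2 * m)) ^ 2 - 2 * (1 - 2 * m)
      = 4 * (12 * m ^ 2 - 11 * m + 2) + 2 by ring, k2 _ hs0 hs4, k2 _ hI0 hI4, hI2]
    ring
  have z3 : ∀ m : ℤ, ((-1 : ℂ) ^ (1 - 2 * (2 * m)) *
        s ^ (3 * (1 - 2 * (2 * m)) ^ 2 - (1 - 2 * (2 * m))) +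
      (-1) ^ (1 - 2 * (2 * m)) *
        (Complex.I * s) ^ (3 * (1 - 2 * (2 * m)) ^ 2 - (1 - 2 * (2 * m)))) / 2 = 0 := by
    intro m
    rw [show 3 * (1 - 2 * (2 * m)) ^ 2 - (1 - 2 * (2 * m))
      = 4 * (12 * m ^ 2 - 5 * m) + 2 by ring, k2 _ hs0 hs4, k2 _ hI0 hI4, hI2]
    ring
  have z4 : ∀ m : ℤ, ((-1 : ℂ) ^ (1 - 2 * (1 - 2 * m)) *
        s ^ (3 * (1 - 2 * (1 - 2 * m)) ^ 2 - (1 - 2 * (1 - 2 * m))) +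
      (-1) ^ (1 - 2 * (1 - 2 * m)) *
        (Complex.I * s) ^ (3 * (1 - 2 * (1 - 2 * m)) ^ 2 - (1 - 2 * (1 - 2 * m)))) / 2 =
      -(q * q ^ (12 * m ^ 2 - (12 - (5 : ℕ)) * m)) := by
    intro m
    rw [(show Odd (1 - 2 * (1 - 2 * m)) from ⟨-(1 - 2 * m), by ring⟩).neg_one_zpow,
      show 3 * (1 - 2 * (1 - 2 * m)) ^ 2 - (1 - 2 * (1 - 2 * m))
      = 4 * (1 + (12 * m ^ 2 - (12 - (5 : ℕ)) * m)) by push_cast; ring, k0 _ hs4, k0 _ hI4,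
      zpow_add₀ hq, zpow_one]
    ring
  simp only [z1, z2, z3, z4, tsum_zero, tsum_neg]
  ring

theorem stmt7 (q : ℂ) (h0 : 0 < ‖q‖) (h1 : ‖q‖ < 1) :
    qpInf q q * ∑' n : ℕ,
        q ^ (2 * (n + 1) ^ 2 - (n + 1)) / ((1 + q ^ (n + 1)) * qp q q (2 * n + 1))
      = tp (q ^ 24) (-q ^ 10) (-q ^ 14) - tp (q ^ 24) (-q ^ 11) (-q ^ 13)
        + q * tp (q ^ 24) (-q ^ 5) (-q ^ 19) - q ^ 2 * tp (q ^ 24) (-q ^ 2) (-q ^ 22) := by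
  have hq : q ≠ 0 := norm_pos_iff.mp h0
  obtain ⟨s, hs⟩ := IsAlgClosed.exists_pow_nat_eq q (n := 4) (by norm_num)
  have hS1 := S1 q h1
  have hS2 := S2 q (s ^ 2) (by rw [← pow_mul]; exact hs) h1
  have hS := hS1.sub hS2
  have hterm : ∀ n : ℕ, q ^ (2 * (n + 1) ^ 2 - (n + 1)) / ((1 + q ^ (n + 1)) * qp q q (2 * n + 1))
      = q ^ (2 * (n + 1) ^ 2 - (n + 1)) / qp q q (2 * (n + 1))
        - q ^ (2 * (n + 1) ^ 2) / qp q q (2 * (n + 1)) := by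
    intro n
    have e1 : q ^ (2 * (n + 1) ^ 2) = q ^ (2 * (n + 1) ^ 2 - (n + 1)) * q ^ (n + 1) := by
      rw [← pow_add, Nat.sub_add_cancel]
      nlinarith
    have e2 : qp q q (2 * (n + 1)) =
        (1 - q ^ (n + 1)) * ((1 + q ^ (n + 1)) * qp q q (2 * n + 1)) := by
      rw [show 2 * (n + 1) = 2 * n + 1 + 1 by ring, qp_succ]
      ring
    have n1 : qp q q (2 * (n + 1)) ≠ 0 := qp_ne q h1 _
    rw [e2] at n1
    have n2 := left_ne_zero_of_mul n1
    have n3 := right_ne_zero_of_mul n1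
    rw [e1, e2, ← sub_div, div_eq_div_iff n3 n1]
    ring
  have hsum : ∑' n : ℕ,
        q ^ (2 * (n + 1) ^ 2 - (n + 1)) / ((1 + q ^ (n + 1)) * qp q q (2 * n + 1)) =
      qpInf q (-q) - (qpInf q (-s ^ 2) + qpInf q (s ^ 2)) / 2 := by
    rw [← hS.tsum_eq, hS.summable.tsum_eq_zero_add]
    simp [hterm]
  rw [hsum, mul_sub, qpInf_sq q h1, R1 q hq h1, R2 q s hs hq h1]
  ring
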